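/- arXiv:math-ph/0410049 — 2 statements merged into one kernel-verified Lean document; each statement's English description precedes it below -/
import Mathlib

section
/- If the pair (U,V) of bounded linear operators on H satisfies the symplectic relations (so that U is invertible), then U⁻¹V = Vᵀ(U⁻¹)ᵀ and V̄U⁻¹ = (U⁻¹)ᵀV*; in particular the operators U⁻¹V and V̄U⁻¹ are transposition-symmetric. -/
open ContinuousLinearMap
open scoped InnerProductSpace

variable {H : Type*} [NormedAddCommGroup H] [InnerProductSpace ℂ H] [CompleteSpace H]

/-- The complex conjugate `Ā := J ∘ A ∘ J` of a bounded operator with respect to the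
conjugation `J`. -/
noncomputable def conjOp (J : H →L⋆[ℂ] H) (A : H →L[ℂ] H) : H →L[ℂ] H :=
  (J.comp A).comp J

/-- The transpose `Aᵀ := J ∘ A* ∘ J` of a bounded operator with respect to the
conjugation `J`. -/
noncomputable def transp (J : H →L⋆[ℂ] H) (A : H →L[ℂ] H) : H →L[ℂ] H :=
  conjOp J (adjoint A)

/-- The pair `(U, V)` satisfies the symplectic relations:
`U U* − V V* = 1`, `U Vᵀ = V Uᵀ`, `U* U − Vᵀ V̄ = 1`, `Uᵀ V̄ = V* U`. -/
def SymplecticPair (J : H →L⋆[ℂ] H) (U V : H →L[ℂ] H) : Prop :=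
  U ∘L adjoint U - V ∘L adjoint V = 1 ∧
  U ∘L transp J V = V ∘L transp J U ∧
  adjoint U ∘L U - transp J V ∘L conjOp J V = 1 ∧
  transp J U ∘L conjOp J V = adjoint V ∘L U

theorem inner_conjugation (J : H →L⋆[ℂ] H) (hJinv : ∀ x, J (J x) = x)
    (hJnorm : ∀ x, ‖J x‖ = ‖x‖) (x y : H) : ⟪J x, y⟫_ℂ = ⟪J y, x⟫_ℂ := by
  have key : ∀ a b : H, ⟪J a, J b⟫_ℂ = ⟪b, a⟫_ℂ := by
    intro a b
    have h1 : J a + J b = J (a + b) := by simp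
    have h2 : J a - J b = J (a - b) := by simp
    have h3 : J a + Complex.I • J b = J (a - Complex.I • b) := by simp
    have h4 : J a - Complex.I • J b = J (a + Complex.I • b) := by simp [sub_eq_add_neg]
    have n1 : ‖b - Complex.I • a‖ = ‖a + Complex.I • b‖ := by
      rw [← one_mul ‖a + Complex.I • b‖, ← Complex.norm_I, ← norm_neg Complex.I, ← norm_smul]
      congr 1
      simp [smul_smul, sub_eq_add_neg, add_comm]
    have n2 : ‖b + Complex.I • a‖ = ‖a - Complex.I • b‖ := by
      rw [← one_mul ‖a - Complex.I • b‖, ← Complex.norm_I, ← norm_smul]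
      congr 1
      simp [smul_smul, sub_eq_add_neg, add_comm]
    rw [inner_eq_sum_norm_sq_div_four (J a), inner_eq_sum_norm_sq_div_four b]
    simp only [RCLike.I_to_complex]
    rw [h1, h2, h3, h4, hJnorm, hJnorm, hJnorm, hJnorm, n1, n2, add_comm b a, norm_sub_rev b a]
  have := key x (J y)
  rwa [hJinv] at this

theorem adjoint_conjOp (J : H →L⋆[ℂ] H) (hJinv : ∀ x, J (J x) = x)
    (hJnorm : ∀ x, ‖J x‖ = ‖x‖) (A : H →L[ℂ] H) :
    adjoint (conjOp J A) = transp J A := by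
  symm
  rw [eq_adjoint_iff]
  intro x y
  change ⟪J (adjoint A (J x)), y⟫_ℂ = ⟪x, J (A (J y))⟫_ℂ
  rw [inner_conjugation J hJinv hJnorm, adjoint_inner_right, ← inner_conj_symm x,
    inner_conjugation J hJinv hJnorm (A (J y)), inner_conj_symm]

theorem conjOp_comp (J : H →L⋆[ℂ] H) (hJinv : ∀ x, J (J x) = x) (A B : H →L[ℂ] H) :
    conjOp J (A ∘L B) = conjOp J A ∘L conjOp J B := by
  ext x
  simp [conjOp, hJinv]

theorem transp_comp (J : H →L⋆[ℂ] H) (hJinv : ∀ x, J (J x) = x) (A B : H →L[ℂ] H) :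
    transp J (A ∘L B) = transp J B ∘L transp J A := by
  rw [transp, adjoint_comp, conjOp_comp J hJinv, transp, transp]

theorem transp_one (J : H →L⋆[ℂ] H) (hJinv : ∀ x, J (J x) = x) :
    transp J (1 : H →L[ℂ] H) = 1 := by
  ext x
  simp [transp, conjOp, hJinv, one_def, adjoint_id]

theorem transp_conjOp (J : H →L⋆[ℂ] H) (hJinv : ∀ x, J (J x) = x)
    (hJnorm : ∀ x, ‖J x‖ = ‖x‖) (A : H →L[ℂ] H) :
    transp J (conjOp J A) = adjoint A := by
  ext x
  rw [transp, adjoint_conjOp J hJinv hJnorm]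
  simp [transp, conjOp, hJinv]

/-- A bounded operator of the form `1 + A* A` is invertible. -/
theorem isUnit_one_add_adjoint_comp (A : H →L[ℂ] H) : IsUnit (1 + adjoint A ∘L A) := by
  refine CStarAlgebra.isUnit_of_le 1 (le_add_of_nonneg_right ?_)
  exact star_mul_self_nonneg A

/-- The first operator of a symplectic pair is invertible. -/
theorem SymplecticPair.isUnit (J : H →L⋆[ℂ] H) (hJinv : ∀ x, J (J x) = x)
    (hJnorm : ∀ x, ‖J x‖ = ‖x‖) {U V : H →L[ℂ] H} (h : SymplecticPair J U V) : IsUnit U := by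
  obtain ⟨h1, -, h3, -⟩ := h
  have hr : IsUnit (U * adjoint U) := by
    have := isUnit_one_add_adjoint_comp (adjoint V)
    rwa [adjoint_adjoint, ← sub_eq_iff_eq_add.mp h1] at this
  have hl : IsUnit (adjoint U * U) := by
    have := isUnit_one_add_adjoint_comp (conjOp J V)
    rwa [adjoint_conjOp J hJinv hJnorm, ← sub_eq_iff_eq_add.mp h3] at this
  obtain ⟨b, hb⟩ := hr.exists_right_inv
  obtain ⟨c, hc⟩ := hl.exists_left_inv
  rw [mul_assoc] at hb
  rw [← mul_assoc] at hc
  exact isUnit_iff_exists_and_exists.mpr ⟨⟨_, hb⟩, ⟨_, hc⟩⟩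

/-- If `(U,V)` satisfies the symplectic relations then `U⁻¹V = Vᵀ(U⁻¹)ᵀ` and
`V̄U⁻¹ = (U⁻¹)ᵀV*`; in particular `U⁻¹V` and `V̄U⁻¹` are transposition-symmetric. -/
theorem statement4 (J : H →L⋆[ℂ] H) (hJinv : ∀ x, J (J x) = x) (hJnorm : ∀ x, ‖J x‖ = ‖x‖)
    (U V : H →L[ℂ] H) (h : SymplecticPair J U V) :
    Ring.inverse U ∘L V = transp J V ∘L transp J (Ring.inverse U) ∧
    conjOp J V ∘L Ring.inverse U = transp J (Ring.inverse U) ∘L adjoint V ∧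
    Ring.inverse U ∘L V = transp J (Ring.inverse U ∘L V) ∧
    conjOp J V ∘L Ring.inverse U = transp J (conjOp J V ∘L Ring.inverse U) := by
  have hU := h.isUnit J hJinv hJnorm
  obtain ⟨-, h2, -, h4⟩ := h
  have hl : Ring.inverse U * U = 1 := Ring.inverse_mul_cancel U hU
  have hr : U * Ring.inverse U = 1 := Ring.mul_inverse_cancel U hU
  have htl : transp J (Ring.inverse U) * transp J U = 1 :=
    (transp_comp J hJinv U (Ring.inverse U)).symm.trans
      ((congrArg (transp J) hr).trans (transp_one J hJinv))
  have htr : transp J U * transp J (Ring.inverse U) = 1 :=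
    (transp_comp J hJinv (Ring.inverse U) U).symm.trans
      ((congrArg (transp J) hl).trans (transp_one J hJinv))
  rw [transp_comp J hJinv, transp_comp J hJinv, transp_conjOp J hJinv hJnorm]
  simp only [← mul_def] at h2 h4 ⊢
  have e1 : Ring.inverse U * V = transp J V * transp J (Ring.inverse U) := by
    calc Ring.inverse U * V
        = Ring.inverse U * (V * transp J U) * transp J (Ring.inverse U) := by
          rw [mul_assoc, mul_assoc, htr, mul_one]
      _ = transp J V * transp J (Ring.inverse U) := by
          rw [← h2, ← mul_assoc, hl, one_mul]
  have e2 : conjOp J V * Ring.inverse U = transp J (Ring.inverse U) * adjoint V := by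
    calc conjOp J V * Ring.inverse U
        = transp J (Ring.inverse U) * (transp J U * conjOp J V) * Ring.inverse U := by
          rw [← mul_assoc, htl, one_mul]
      _ = transp J (Ring.inverse U) * adjoint V := by
          rw [h4, mul_assoc, mul_assoc, hr, mul_one]
  exact ⟨e1, e2, e1, e2⟩
end

section
/- If the pair (U,V) of bounded linear operators on H satisfies the symplectic relations and Z is a transposition-symmetric bounded operator with ‖Z‖ < 1 (so that Ū + V̄ Z and U* + Z V* are invertible), then the two expressions for the Siegel-disc action coincide: (U Z + V)(Ū + V̄ Z)⁻¹ = (U* + Z V*)⁻¹(Vᵀ + Z Uᵀ). -/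
open ContinuousLinearMap
open scoped InnerProductSpace

variable {H : Type*} [NormedAddCommGroup H] [InnerProductSpace ℂ H] [CompleteSpace H]

/-- A conjugate-linear isometry reverses the arguments of the inner product. -/
lemma inner_conjugation_conjugation (J : H →L⋆[ℂ] H) (hJnorm : ∀ x, ‖J x‖ = ‖x‖) (x y : H) :
    ⟪J x, J y⟫_ℂ = ⟪y, x⟫_ℂ := by
  have hsub : ∀ c : ℂ, ‖J x - c • J y‖ = ‖x - (starRingEnd ℂ c) • y‖ := fun c => by
    rw [← hJnorm (x - _)]; simp
  have hadd : ∀ c : ℂ, ‖J x + c • J y‖ = ‖x + (starRingEnd ℂ c) • y‖ := fun c => by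
    rw [← hJnorm (x + _)]; simp
  have h₁ := hsub 1
  have h₂ := hadd 1
  have h₃ := hsub Complex.I
  have h₄ := hadd Complex.I
  simp only [map_one, one_smul, Complex.conj_I, neg_smul, sub_neg_eq_add, ← sub_eq_add_neg]
    at h₁ h₂ h₃ h₄
  rw [← inner_conj_symm y x, inner_eq_sum_norm_sq_div_four (J x), inner_eq_sum_norm_sq_div_four x]
  simp only [RCLike.I_to_complex, h₁, h₂, h₃, h₄]
  simp only [map_div₀, map_add, map_sub, map_mul, map_pow, Complex.coe_algebraMap,
    Complex.conj_ofReal, Complex.conj_I, map_ofNat]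
  ring

lemma conjOp_apply (J : H →L⋆[ℂ] H) (A : H →L[ℂ] H) (x : H) : conjOp J A x = J (A (J x)) := rfl

lemma conjOp_mul (J : H →L⋆[ℂ] H) (hJinv : ∀ x, J (J x) = x) (A B : H →L[ℂ] H) :
    conjOp J (A * B) = conjOp J A * conjOp J B := by
  ext x; simp [conjOp_apply, hJinv]

lemma conjOp_one (J : H →L⋆[ℂ] H) (hJinv : ∀ x, J (J x) = x) :
    conjOp J (1 : H →L[ℂ] H) = 1 := by
  ext x; simp [conjOp_apply, hJinv]

lemma conjOp_add (J : H →L⋆[ℂ] H) (A B : H →L[ℂ] H) :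
    conjOp J (A + B) = conjOp J A + conjOp J B := by
  ext x; simp [conjOp_apply]

lemma conjOp_sub (J : H →L⋆[ℂ] H) (A B : H →L[ℂ] H) :
    conjOp J (A - B) = conjOp J A - conjOp J B := by
  ext x; simp [conjOp_apply]

lemma conjOp_conjOp (J : H →L⋆[ℂ] H) (hJinv : ∀ x, J (J x) = x) (A : H →L[ℂ] H) :
    conjOp J (conjOp J A) = A := by
  ext x; simp [conjOp_apply, hJinv]

lemma star_conjOp (J : H →L⋆[ℂ] H) (hJinv : ∀ x, J (J x) = x) (hJnorm : ∀ x, ‖J x‖ = ‖x‖)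
    (A : H →L[ℂ] H) : star (conjOp J A) = conjOp J (star A) := by
  rw [star_eq_adjoint, star_eq_adjoint, eq_comm, eq_adjoint_iff]
  intro x y
  have h₁ := inner_conjugation_conjugation J hJnorm (adjoint A (J x)) (J y)
  have h₂ := inner_conjugation_conjugation J hJnorm (J x) (A (J y))
  rw [hJinv] at h₁ h₂
  rw [conjOp_apply, conjOp_apply, h₁, h₂, adjoint_inner_right]

lemma IsUnit.conjOp {J : H →L⋆[ℂ] H} (hJinv : ∀ x, J (J x) = x) {A : H →L[ℂ] H}
    (hA : IsUnit A) : IsUnit (conjOp J A) := by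
  obtain ⟨B, hAB, hBA⟩ := isUnit_iff_exists.mp hA
  refine isUnit_iff_exists.mpr ⟨_root_.conjOp J B, ?_, ?_⟩
  · rw [← conjOp_mul J hJinv, hAB, conjOp_one J hJinv]
  · rw [← conjOp_mul J hJinv, hBA, conjOp_one J hJinv]

lemma isUnit_one_add_star_mul_self (A : H →L[ℂ] H) : IsUnit (1 + star A * A) :=
  CStarAlgebra.isUnit_of_le 1 (le_add_of_nonneg_right (star_mul_self_nonneg A))

/-- If `A A* - B B* = 1` with `A` invertible, then `A* + Z B*` is invertible for every strict
contraction `Z`. -/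
lemma isUnit_star_add_mul_star {A B Z : H →L[ℂ] H} (hA : IsUnit A)
    (h : A * star A - B * star B = 1) (hZ : ‖Z‖ < 1) : IsUnit (star A + Z * star B) := by
  obtain ⟨C, hAC, hCA⟩ := isUnit_iff_exists.mp hA.star
  have hle : ∀ x, ‖star B x‖ ≤ ‖star A x‖ := by
    intro x
    have hx : ‖star A x‖ ^ 2 - ‖star B x‖ ^ 2 = ‖x‖ ^ 2 := by
      have := congrArg (fun T : H →L[ℂ] H => RCLike.re ⟪T x, x⟫_ℂ) h
      simpa [inner_sub_left, star_eq_adjoint, ← adjoint_inner_right, inner_self_eq_norm_sq,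
        ← Complex.ofReal_pow] using this
    exact le_of_sq_le_sq (by nlinarith [sq_nonneg ‖x‖]) (norm_nonneg _)
  have hBC : ‖star B * C‖ ≤ 1 := by
    refine opNorm_le_bound _ zero_le_one fun x => ?_
    have hx : star A (C x) = x := congrArg (fun T : H →L[ℂ] H => T x) hAC
    simpa [hx] using hle (C x)
  have hlt : ‖-(Z * (star B * C))‖ < 1 := by
    rw [norm_neg]
    calc ‖Z * (star B * C)‖ ≤ ‖Z‖ * ‖star B * C‖ := norm_mul_le _ _
      _ ≤ ‖Z‖ := mul_le_of_le_one_right (norm_nonneg _) hBC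
      _ < 1 := hZ
  have hunit := (isUnit_one_sub_of_norm_lt_one hlt).mul hA.star
  rwa [sub_neg_eq_add, add_mul, one_mul, mul_assoc, mul_assoc, hCA, mul_one] at hunit

/-- The first component of a symplectic pair is invertible. -/
lemma SymplecticPair.isUnit_left {J : H →L⋆[ℂ] H} (hJinv : ∀ x, J (J x) = x)
    (hJnorm : ∀ x, ‖J x‖ = ‖x‖) {U V : H →L[ℂ] H} (h : SymplecticPair J U V) : IsUnit U := by
  obtain ⟨h₁, -, h₃, -⟩ := h
  have hr : IsUnit (U * star U) := by
    have e : U * star U = 1 + star (star V) * star V := by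
      rw [star_star]; exact sub_eq_iff_eq_add.mp h₁
    exact e ▸ isUnit_one_add_star_mul_self _
  have hl : IsUnit (star U * U) := by
    have e : star U * U = 1 + star (conjOp J V) * conjOp J V := by
      rw [star_conjOp J hJinv hJnorm]; exact sub_eq_iff_eq_add.mp h₃
    exact e ▸ isUnit_one_add_star_mul_self _
  obtain ⟨C, hC, -⟩ := isUnit_iff_exists.mp hr
  obtain ⟨D, -, hD⟩ := isUnit_iff_exists.mp hl
  rw [mul_assoc] at hC
  rw [← mul_assoc] at hD
  exact isUnit_iff_exists.mpr ⟨_, hC, left_inv_eq_right_inv hD hC ▸ hD⟩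

/-- The two expressions for the Siegel-disc action coincide:
`(U Z + V)(Ū + V̄ Z)⁻¹ = (U* + Z V*)⁻¹(Vᵀ + Z Uᵀ)`. -/
theorem statement9 (J : H →L⋆[ℂ] H) (hJinv : ∀ x, J (J x) = x) (hJnorm : ∀ x, ‖J x‖ = ‖x‖)
    (U V : H →L[ℂ] H) (h : SymplecticPair J U V)
    (Z : H →L[ℂ] H) (hZsym : Z = transp J Z) (hZ : ‖Z‖ < 1) :
    (U ∘L Z + V) ∘L Ring.inverse (conjOp J U + conjOp J V ∘L Z)
      = Ring.inverse (adjoint U + Z ∘L adjoint V) ∘L (transp J V + Z ∘L transp J U) := by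
  have hU := h.isUnit_left hJinv hJnorm
  obtain ⟨h₁, -, h₃, h₄⟩ := h
  simp only [transp, ← star_eq_adjoint, ← mul_def] at *
  have hB : IsUnit (star U + Z * star V) := isUnit_star_add_mul_star hU h₁ hZ
  have hA : IsUnit (conjOp J U + conjOp J V * Z) := by
    have e : conjOp J U + conjOp J V * Z = conjOp J (star (star U + Z * star V)) := by
      rw [star_add, star_mul, star_star, star_star, conjOp_add, conjOp_mul J hJinv, ← hZsym]
    exact e ▸ hB.star.conjOp hJinv
  have h₃' := congrArg (conjOp J) h₃
  have h₄' := congrArg (conjOp J) h₄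
  simp only [conjOp_sub, conjOp_mul J hJinv, conjOp_conjOp J hJinv, conjOp_one J hJinv]
    at h₃' h₄'
  have key : (star U + Z * star V) * (U * Z + V)
      = (conjOp J (star V) + Z * conjOp J (star U)) * (conjOp J U + conjOp J V * Z) := by
    rw [sub_eq_iff_eq_add] at h₃ h₃'
    calc (star U + Z * star V) * (U * Z + V)
        = star U * U * Z + star U * V + Z * (star V * U) * Z + Z * (star V * V) := by noncomm_ring
      _ = conjOp J (star V) * conjOp J U + conjOp J (star V) * conjOp J V * Z
          + Z * (conjOp J (star U) * conjOp J U) + Z * (conjOp J (star U) * conjOp J V) * Z := by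
        rw [h₃, h₃', h₄, h₄']; noncomm_ring
      _ = _ := by noncomm_ring
  rw [← Ring.inverse_mul_cancel_left _ ((U * Z + V) * _) hB, ← mul_assoc _ (U * Z + V), key,
    Ring.mul_inverse_cancel_right _ _ hA]
end
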